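/- Let Ω ⊆ ℝ^d be a bounded open set with smooth boundary, T > 0, ε > 0 and δ > 0. Let f = (f₁,…,f_d) with each f_j ∈ C²(ℝ) and f_j′ bounded, let B ∈ C¹(ℝ) be bounded with B ≥ 0, and let u be a classical solution of the regularized viscosity problem with flux f, viscosity coefficient B + δ, parameter ε and data u₀ ∈ C_c^∞(Ω). Then for each j = 1,…,d and every φ ∈ C_c^∞(Ω_T): | ε ∫_{Ω_T} B(u) ∂_{x_j}u ∂_{x_j}φ dx dt | ≤ √ε · (sup_ℝ B)^{1/2} · (‖u₀‖_{L²(Ω)}/√2) · ‖∂_{x_j}φ‖_{L²(Ω_T)}. In particular, if ‖u₀‖_{L^∞(Ω)} ≤ A then this quantity tends to 0 as ε → 0, uniformly in δ. -/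

import Mathlib

open MeasureTheory Set

noncomputable section

/-- The spatial partial derivative of `v` in the `j`-th coordinate direction. -/
def pderiv' {d : ℕ} (v : (Fin d → ℝ) → ℝ) (j : Fin d) (x : Fin d → ℝ) : ℝ :=
  fderiv ℝ v x (Pi.single j 1)

/-- A classical solution of the regularized viscosity problem
`∂ₜ u + Σⱼ ∂ⱼ(fⱼ(u)) = ε Σⱼ ∂ⱼ((B(u)+δ) ∂ⱼ u)` on `Ω × (0,T)`, with homogeneous
Dirichlet boundary condition on `∂Ω × (0,T)` and initial data `u₀`. -/
structure IsClassicalSolution {d : ℕ} (Ω : Set (Fin d → ℝ)) (T ε δ : ℝ)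
    (f : Fin d → ℝ → ℝ) (B : ℝ → ℝ) (u₀ : (Fin d → ℝ) → ℝ)
    (u : (Fin d → ℝ) → ℝ → ℝ) : Prop where
  cont : ContinuousOn (fun p : (Fin d → ℝ) × ℝ => u p.1 p.2) (closure Ω ×ˢ Set.Icc 0 T)
  diff_t : ∀ x ∈ Ω, ∀ t ∈ Set.Ioo 0 T, DifferentiableAt ℝ (u x) t
  diff_x : ∀ x ∈ Ω, ∀ t ∈ Set.Ioo 0 T, DifferentiableAt ℝ (fun y => u y t) x
  diff_xx : ∀ j, ∀ x ∈ Ω, ∀ t ∈ Set.Ioo 0 T,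
      DifferentiableAt ℝ (fun y => pderiv' (fun z => u z t) j y) x
  cont_dt : ContinuousOn (fun p : (Fin d → ℝ) × ℝ => deriv (u p.1) p.2) (Ω ×ˢ Set.Ioo 0 T)
  cont_dx : ∀ j, ContinuousOn
      (fun p : (Fin d → ℝ) × ℝ => pderiv' (fun y => u y p.2) j p.1) (Ω ×ˢ Set.Ioo 0 T)
  cont_dxx : ∀ i j, ContinuousOn
      (fun p : (Fin d → ℝ) × ℝ => pderiv' (pderiv' (fun y => u y p.2) j) i p.1)
      (Ω ×ˢ Set.Ioo 0 T)
  pde : ∀ x ∈ Ω, ∀ t ∈ Set.Ioo 0 T,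
      deriv (u x) t + ∑ j, pderiv' (fun y => f j (u y t)) j x
        = ε * ∑ j, pderiv' (fun y => (B (u y t) + δ) * pderiv' (fun z => u z t) j y) j x
  bc : ∀ x ∈ frontier Ω, ∀ t ∈ Set.Ioo 0 T, u x t = 0
  ic : ∀ x ∈ Ω, u x 0 = u₀ x

theorem hasDerivAt_primitive {h : ℝ → ℝ} (hh : Continuous h) (s : ℝ) :
    HasDerivAt (fun s => ∫ r in (0 : ℝ)..s, h r) (h s) s :=
  intervalIntegral.integral_hasDerivAt_right (hh.intervalIntegrable _ _)
    hh.aestronglyMeasurable.stronglyMeasurableAtFilter hh.continuousAt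

theorem continuous_primitive_of_continuous {h : ℝ → ℝ} (hh : Continuous h) :
    Continuous (fun s => ∫ r in (0 : ℝ)..s, h r) :=
  continuous_iff_continuousAt.2 fun s => (hasDerivAt_primitive hh s).continuousAt

theorem primitive_primitive_nonneg {h : ℝ → ℝ} (h0 : ∀ r, 0 ≤ h r) (s : ℝ) :
    0 ≤ ∫ r in (0 : ℝ)..s, ∫ q in (0 : ℝ)..r, h q := by
  rcases le_total 0 s with hs | hs
  · exact intervalIntegral.integral_nonneg hs fun r hr =>
      intervalIntegral.integral_nonneg hr.1 fun q _ => h0 q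
  · rw [intervalIntegral.integral_symm, ← intervalIntegral.integral_neg]
    refine intervalIntegral.integral_nonneg hs fun r hr => ?_
    rw [← intervalIntegral.integral_symm]
    exact intervalIntegral.integral_nonneg hr.2 fun q _ => h0 q

theorem primitive_eq_zero_of_abs_le {h : ℝ → ℝ} {η : ℝ} (h0 : ∀ r, |r| ≤ η → h r = 0) {s : ℝ}
    (hs : |s| ≤ η) : ∫ r in (0 : ℝ)..s, h r = 0 := by
  refine intervalIntegral.integral_zero_ae (Filter.Eventually.of_forall fun r hr => h0 r ?_)
  refine le_trans ?_ hs
  have := uIoc_subset_uIcc hr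
  simpa using abs_sub_left_of_mem_uIcc this

/-- A continuous cutoff which vanishes on `[-η, η]` and equals one outside `(-2η, 2η)`. -/
def cutoff (η s : ℝ) : ℝ := min 1 (max 0 (|s| / η - 1))

theorem continuous_cutoff (η : ℝ) : Continuous (cutoff η) := by
  unfold cutoff; fun_prop

theorem cutoff_nonneg (η s : ℝ) : 0 ≤ cutoff η s := by simp [cutoff]

theorem cutoff_le_one (η s : ℝ) : cutoff η s ≤ 1 := by simp [cutoff]

theorem cutoff_of_abs_le {η s : ℝ} (hη : 0 < η) (hs : |s| ≤ η) : cutoff η s = 0 := by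
  have : |s| / η - 1 ≤ 0 := by rw [sub_nonpos, div_le_one hη]; exact hs
  simp [cutoff, max_eq_left this]

theorem cutoff_of_two_mul_le {η s : ℝ} (hη : 0 < η) (hs : 2 * η ≤ |s|) : cutoff η s = 1 := by
  have : 1 ≤ |s| / η - 1 := by rw [le_sub_iff_add_le, le_div_iff₀ hη]; linarith
  rw [cutoff, min_eq_left (this.trans (le_max_right _ _))]

/-- The truncated identity, i.e. the primitive of `cutoff η`. -/
def cutoffId (η s : ℝ) : ℝ := ∫ r in (0 : ℝ)..s, cutoff η r

/-- The truncated energy density, i.e. the primitive of `cutoffId η`. -/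
def cutoffEnergy (η s : ℝ) : ℝ := ∫ r in (0 : ℝ)..s, cutoffId η r

theorem hasDerivAt_cutoffId (η s : ℝ) : HasDerivAt (cutoffId η) (cutoff η s) s :=
  hasDerivAt_primitive (continuous_cutoff η) s

theorem continuous_cutoffId (η : ℝ) : Continuous (cutoffId η) :=
  continuous_primitive_of_continuous (continuous_cutoff η)

theorem hasDerivAt_cutoffEnergy (η s : ℝ) : HasDerivAt (cutoffEnergy η) (cutoffId η s) s :=
  hasDerivAt_primitive (continuous_cutoffId η) s

theorem continuous_cutoffEnergy (η : ℝ) : Continuous (cutoffEnergy η) :=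
  continuous_primitive_of_continuous (continuous_cutoffId η)

theorem cutoffId_of_abs_le {η s : ℝ} (hη : 0 < η) (hs : |s| ≤ η) : cutoffId η s = 0 :=
  primitive_eq_zero_of_abs_le (fun _ hr => cutoff_of_abs_le hη hr) hs

theorem cutoffEnergy_nonneg (η s : ℝ) : 0 ≤ cutoffEnergy η s :=
  primitive_primitive_nonneg (cutoff_nonneg η) s

theorem cutoffEnergy_le (η s : ℝ) : cutoffEnergy η s ≤ s ^ 2 / 2 := by
  have h := primitive_primitive_nonneg (h := fun r => 1 - cutoff η r)
    (fun r => sub_nonneg.2 (cutoff_le_one η r)) s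
  have h1 : ∀ r : ℝ, ∫ q in (0 : ℝ)..r, (1 - cutoff η q) = r - cutoffId η r := fun r => by
    rw [intervalIntegral.integral_sub (by simp) ((continuous_cutoff η).intervalIntegrable _ _)]
    simp [cutoffId]
  simp only [h1] at h
  rw [intervalIntegral.integral_sub (by simp) ((continuous_cutoffId η).intervalIntegrable _ _)] at h
  simp only [integral_id] at h
  unfold cutoffEnergy
  linarith

theorem countable_zeros_of_hasDerivAt_ne_zero (h : ℝ → ℝ) :
    {s | h s = 0 ∧ ∃ h', h' ≠ 0 ∧ HasDerivAt h h' s}.Countable := by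
  set S := {s | h s = 0 ∧ ∃ h', h' ≠ 0 ∧ HasDerivAt h h' s}
  refine (countable_setOfPred_isolated_right_within (s := S)).mono fun s hs => ?_
  refine ⟨hs, ?_⟩
  obtain ⟨h', hne, hd⟩ := hs.2
  have hmono : nhdsWithin s (S ∩ Ioi s) ≤ nhdsWithin s {s}ᶜ :=
    nhdsWithin_mono s fun y hy => ne_of_gt hy.2
  refine Filter.empty_mem_iff_bot.1 ?_
  filter_upwards [hmono (hd.eventually_ne hne (c := 0)), self_mem_nhdsWithin] with y hy hyS
  exact hy hyS.1.1

theorem ae_lineDeriv_eq_zero_of_eq_zero {E : Type*} [NormedAddCommGroup E] [NormedSpace ℝ E]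
    [FiniteDimensional ℝ E] [MeasurableSpace E] [BorelSpace E] (μ : Measure E)
    [μ.IsAddHaarMeasure] {O : Set E} (hO : IsOpen O) {w w' : E → ℝ} {v : E}
    (hw : ContinuousOn w O) (hw' : ContinuousOn w' O)
    (hd : ∀ x ∈ O, HasLineDerivAt ℝ w (w' x) x v) :
    ∀ᵐ x ∂μ, x ∈ O → w x = 0 → w' x = 0 := by
  have hmeas : MeasurableSet {x | x ∈ O → w x = 0 → w' x = 0} := by
    have h : {x | x ∈ O → w x = 0 → w' x = 0} = Oᶜ ∪ ((O ∩ w ⁻¹' {0}ᶜ) ∪ (O \ (O ∩ w' ⁻¹' {0}ᶜ))) := by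
      ext x; simp; tauto
    rw [h]
    have h1 := (hw.isOpen_inter_preimage hO (isOpen_compl_singleton (x := (0:ℝ)))).measurableSet
    have h2 := (hw'.isOpen_inter_preimage hO (isOpen_compl_singleton (x := (0:ℝ)))).measurableSet
    exact hO.measurableSet.compl.union (h1.union (hO.measurableSet.diff h2))
  refine ae_mem_of_ae_add_linearMap_mem (LinearMap.toSpanSingleton ℝ E v) volume μ hmeas fun y => ?_
  have hnull := (countable_zeros_of_hasDerivAt_ne_zero fun s => w (y + s • v)).measure_zero volume
  refine measure_mono_null ?_ hnull
  intro s hs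
  replace hs : ¬(y + s • v ∈ O → w (y + s • v) = 0 → w' (y + s • v) = 0) := hs
  simp only [Classical.not_imp] at hs
  refine ⟨hs.2.1, _, hs.2.2, ?_⟩
  have := hd _ hs.1
  have h2 : HasDerivAt (fun t => w (y + s • v + t • v)) (w' (y + s • v)) (s - s) := by
    simpa [HasLineDerivAt] using this
  have := h2.comp_sub_const s s
  refine this.congr_of_eventuallyEq (Filter.Eventually.of_forall fun t => ?_)
  simp only [add_assoc, ← add_smul]; congr 3; ring

/-- The integral of a directional derivative of a function supported in a compact set vanishes. -/
theorem setIntegral_lineDeriv_eq_zero {E : Type*} [NormedAddCommGroup E] [NormedSpace ℝ E]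
    [FiniteDimensional ℝ E] [MeasurableSpace E] [BorelSpace E] (μ : Measure E)
    [μ.IsAddHaarMeasure] {O K : Set E} (hO : IsOpen O) (hK : IsCompact K) (hKO : K ⊆ O)
    {w w' : E → ℝ} {v : E} (hw : ContinuousOn w O) (hw' : ContinuousOn w' O)
    (hd : ∀ x ∈ O, HasLineDerivAt ℝ w (w' x) x v) (h0 : ∀ x ∈ O \ K, w x = 0) :
    ∫ x in K, w' x ∂μ = 0 := by
  have hKm := hK.measurableSet
  have hline : ∀ x : E, Filter.Tendsto (fun t : ℝ => x + t • v) (nhds 0) (nhds x) := fun x => by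
    have : Continuous fun t : ℝ => x + t • v := by fun_prop
    simpa using this.tendsto 0
  have hder : ∀ x, HasLineDerivAt ℝ (K.indicator w) (K.indicator w' x) x v := by
    intro x
    by_cases hx : x ∈ K
    · rw [indicator_of_mem hx]
      refine HasDerivAt.congr_of_eventuallyEq (hd x (hKO hx)) ?_
      filter_upwards [(hline x).eventually (hO.mem_nhds (hKO hx))] with t ht
      by_cases htK : x + t • v ∈ K
      · rw [indicator_of_mem htK]
      · rw [indicator_of_notMem htK, h0 _ ⟨ht, htK⟩]
    · rw [indicator_of_notMem hx]
      refine HasDerivAt.congr_of_eventuallyEq (hasDerivAt_const (0 : ℝ) (0 : ℝ)) ?_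
      filter_upwards [(hline x).eventually (hK.isClosed.isOpen_compl.mem_nhds hx)] with t ht
      rw [indicator_of_notMem ht]
  have hint : ∀ {k : E → ℝ}, ContinuousOn k O → Integrable (K.indicator k) μ := fun hk =>
    (integrable_indicator_iff hKm).2 ((hk.mono hKO).integrableOn_compact hK)
  have := integral_bilinear_hasLineDerivAt_right_eq_neg_left_of_integrable (μ := μ) (v := v)
    (f := K.indicator w) (f' := K.indicator w') (g := fun _ => (1 : ℝ)) (g' := fun _ => (0 : ℝ))
    (B := ContinuousLinearMap.mul ℝ ℝ) (by simpa using hint hw') (by simp) (by simpa using hint hw)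
    (fun x _ => hder x) (fun x _ => hasDerivAt_const _ _)
  simp only [ContinuousLinearMap.mul_apply', mul_zero, mul_one, integral_zero,
    integral_indicator hKm] at this
  linarith

section ClassicalSolution

variable {d : ℕ} {Ω : Set (Fin d → ℝ)} {T ε δ : ℝ} {f : Fin d → ℝ → ℝ} {B : ℝ → ℝ}
  {u₀ : (Fin d → ℝ) → ℝ} {u : (Fin d → ℝ) → ℝ → ℝ}

namespace IsClassicalSolution

theorem hasLineDerivAt_x (hu : IsClassicalSolution Ω T ε δ f B u₀ u) (j : Fin d)
    {x : Fin d → ℝ} (hx : x ∈ Ω) {t : ℝ} (ht : t ∈ Ioo 0 T) :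
    HasLineDerivAt ℝ (fun y => u y t) (pderiv' (fun y => u y t) j x) x (Pi.single j 1) :=
  (hu.diff_x x hx t ht).hasFDerivAt.hasLineDerivAt _

theorem hasLineDerivAt_comp (hu : IsClassicalSolution Ω T ε δ f B u₀ u) {h : ℝ → ℝ} {h' : ℝ}
    (j : Fin d) {x : Fin d → ℝ} (hx : x ∈ Ω) {t : ℝ} (ht : t ∈ Ioo 0 T)
    (hh : HasDerivAt h h' (u x t)) :
    HasLineDerivAt ℝ (fun y => h (u y t)) (h' * pderiv' (fun y => u y t) j x) x
      (Pi.single j 1) := by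
  refine HasDerivAt.comp (0 : ℝ) (h₂ := h) ?_ (hu.hasLineDerivAt_x j hx ht)
  simpa using hh

theorem pderiv'_comp (hu : IsClassicalSolution Ω T ε δ f B u₀ u) {h : ℝ → ℝ}
    (hh : Differentiable ℝ h) (j : Fin d) {x : Fin d → ℝ} (hx : x ∈ Ω) {t : ℝ}
    (ht : t ∈ Ioo 0 T) :
    pderiv' (fun y => h (u y t)) j x = deriv h (u x t) * pderiv' (fun y => u y t) j x := by
  have h1 := ((hh (u x t)).comp x (hu.diff_x x hx t ht)).hasFDerivAt.hasLineDerivAt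
    (Pi.single j 1)
  exact HasDerivAt.unique h1 (hu.hasLineDerivAt_comp j hx ht (hh _).hasDerivAt)

theorem hasLineDerivAt_flux (hu : IsClassicalSolution Ω T ε δ f B u₀ u)
    (hB : Differentiable ℝ B) (j : Fin d) {x : Fin d → ℝ} (hx : x ∈ Ω) {t : ℝ}
    (ht : t ∈ Ioo 0 T) :
    HasLineDerivAt ℝ (fun y => (B (u y t) + δ) * pderiv' (fun z => u z t) j y)
      (pderiv' (fun y => (B (u y t) + δ) * pderiv' (fun z => u z t) j y) j x) x
      (Pi.single j 1) := by
  have h1 : DifferentiableAt ℝ (fun y => B (u y t) + δ) x :=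
    ((hB (u x t)).comp x (hu.diff_x x hx t ht)).add_const δ
  exact (h1.mul (hu.diff_xx j x hx t ht)).hasFDerivAt.hasLineDerivAt _

theorem pderiv'_flux (hu : IsClassicalSolution Ω T ε δ f B u₀ u)
    (hB : Differentiable ℝ B) (j : Fin d) {x : Fin d → ℝ} (hx : x ∈ Ω) {t : ℝ}
    (ht : t ∈ Ioo 0 T) :
    pderiv' (fun y => (B (u y t) + δ) * pderiv' (fun z => u z t) j y) j x
      = deriv B (u x t) * pderiv' (fun y => u y t) j x * pderiv' (fun y => u y t) j x
        + (B (u x t) + δ) * pderiv' (pderiv' (fun y => u y t) j) j x := by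
  have h1 := (hu.hasLineDerivAt_comp j hx ht (hB (u x t)).hasDerivAt)
  have h2 : HasLineDerivAt ℝ (fun y => pderiv' (fun z => u z t) j y) _ x (Pi.single j 1) :=
    (hu.diff_xx j x hx t ht).hasFDerivAt.hasLineDerivAt _
  have h3 := HasDerivAt.mul (HasDerivAt.add_const δ h1) h2
  simp only [zero_smul, add_zero] at h3
  exact HasDerivAt.unique (hu.hasLineDerivAt_flux hB j hx ht) h3

theorem continuousOn_slice {k : (Fin d → ℝ) × ℝ → ℝ} (hk : ContinuousOn k (Ω ×ˢ Ioo 0 T))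
    {t : ℝ} (ht : t ∈ Ioo 0 T) : ContinuousOn (fun x => k (x, t)) Ω :=
  hk.comp (by fun_prop) fun _ hx => ⟨hx, ht⟩

theorem continuousOn_u (hu : IsClassicalSolution Ω T ε δ f B u₀ u) :
    ContinuousOn (fun p : (Fin d → ℝ) × ℝ => u p.1 p.2) (Ω ×ˢ Ioo 0 T) :=
  hu.cont.mono (prod_mono subset_closure Ioo_subset_Icc_self)

/-- The truncated energy identity on a time slice. -/
theorem setIntegral_energy_eq_zero (hu : IsClassicalSolution Ω T ε δ f B u₀ u)
    (hΩ : IsOpen Ω) (hf : ∀ j, ContDiff ℝ 2 (f j)) (hB : ContDiff ℝ 1 B) {η : ℝ} (hη : 0 < η)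
    {t : ℝ} (ht : t ∈ Ioo 0 T) {K : Set (Fin d → ℝ)} (hK : IsCompact K) (hKΩ : K ⊆ Ω)
    (h0 : ∀ x ∈ Ω \ K, |u x t| ≤ η) :
    ∫ x in K, (cutoffId η (u x t) * deriv (u x) t
      + ε * ∑ j, cutoff η (u x t) * (B (u x t) + δ) * pderiv' (fun y => u y t) j x ^ 2) = 0 := by
  have hBd : Differentiable ℝ B := hB.differentiable one_ne_zero
  have hfd : ∀ j, Differentiable ℝ (f j) := fun j => (hf j).differentiable two_ne_zero
  have hf'c : ∀ j, Continuous (deriv (f j)) := fun j => (hf j).continuous_deriv one_le_two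
  have hB'c : Continuous (deriv B) := hB.continuous_deriv le_rfl
  have huc : ContinuousOn (fun x => u x t) Ω := continuousOn_slice hu.continuousOn_u ht
  have hpc : ∀ j, ContinuousOn (pderiv' (fun y => u y t) j) Ω :=
    fun j => continuousOn_slice (hu.cont_dx j) ht
  have hppc : ∀ j, ContinuousOn (pderiv' (pderiv' (fun y => u y t) j) j) Ω :=
    fun j => continuousOn_slice (hu.cont_dxx j j) ht
  have hcomp : ∀ {h : ℝ → ℝ}, Continuous h → ContinuousOn (fun x => h (u x t)) Ω :=
    fun hh => hh.comp_continuousOn huc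
  have hQc : ∀ j, ContinuousOn
      (pderiv' (fun y => (B (u y t) + δ) * pderiv' (fun z => u z t) j y) j) Ω := by
    intro j
    refine ContinuousOn.congr ?_ fun x hx => hu.pderiv'_flux hBd j hx ht
    exact (((hcomp hB'c).mul (hpc j)).mul (hpc j)).add
      (((hcomp hB.continuous).add continuousOn_const).mul (hppc j))
  have hHc : ∀ j, Continuous fun r => cutoffId η r * deriv (f j) r :=
    fun j => (continuous_cutoffId η).mul (hf'c j)
  set w' : Fin d → (Fin d → ℝ) → ℝ := fun j x =>
    ε * (cutoff η (u x t) * pderiv' (fun y => u y t) j x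
          * ((B (u x t) + δ) * pderiv' (fun y => u y t) j x)
        + cutoffId η (u x t)
          * pderiv' (fun y => (B (u y t) + δ) * pderiv' (fun z => u z t) j y) j x)
      - cutoffId η (u x t) * deriv (f j) (u x t) * pderiv' (fun y => u y t) j x with hw'
  have hw'c : ∀ j, ContinuousOn (w' j) Ω := fun j =>
    (continuousOn_const.mul ((((hcomp (continuous_cutoff η)).mul (hpc j)).mul
      (((hcomp hB.continuous).add continuousOn_const).mul (hpc j))).add
      ((hcomp (continuous_cutoffId η)).mul (hQc j)))).sub ((hcomp (hHc j)).mul (hpc j))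
  have hzero : ∀ j, ∫ x in K, w' j x = 0 := by
    intro j
    refine setIntegral_lineDeriv_eq_zero volume hΩ hK hKΩ (v := Pi.single j 1)
      (w := fun x => ε * (cutoffId η (u x t) * ((B (u x t) + δ) * pderiv' (fun y => u y t) j x))
        - ∫ r in (0 : ℝ)..(u x t), cutoffId η r * deriv (f j) r) ?_ (hw'c j) ?_ ?_
    · exact (continuousOn_const.mul ((hcomp (continuous_cutoffId η)).mul
        (((hcomp hB.continuous).add continuousOn_const).mul (hpc j)))).sub
        (hcomp (continuous_primitive_of_continuous (hHc j)))
    · intro x hx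
      have h1 := hu.hasLineDerivAt_comp j hx ht (hasDerivAt_cutoffId η (u x t))
      have h2 := hu.hasLineDerivAt_flux hBd j hx ht
      have h3 := hu.hasLineDerivAt_comp j hx ht (hasDerivAt_primitive (hHc j) (u x t))
      have h4 := HasDerivAt.sub (HasDerivAt.const_mul ε (HasDerivAt.mul h1 h2)) h3
      simp only [zero_smul, add_zero] at h4
      exact h4
    · intro x hx
      have h1 := h0 x hx
      have h2 : ∫ r in (0 : ℝ)..(u x t), cutoffId η r * deriv (f j) r = 0 :=
        primitive_eq_zero_of_abs_le
          (fun r hr => by rw [cutoffId_of_abs_le hη hr, zero_mul]) h1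
      simp only [h2, cutoffId_of_abs_le hη h1]
      ring
  have hsum : ∫ x in K, ∑ j, w' j x = 0 := by
    rw [integral_finsetSum _ fun j _ => ((hw'c j).mono hKΩ).integrableOn_compact hK]
    simp [hzero]
  rw [← hsum]
  refine setIntegral_congr_fun hK.measurableSet fun x hxK => ?_
  have hx := hKΩ hxK
  have hpde := hu.pde x hx t ht
  simp only [fun j => hu.pderiv'_comp (hfd j) j hx ht] at hpde
  have hpde' : deriv (u x) t = _ := eq_sub_of_add_eq hpde
  simp only [hw', hpde', Finset.sum_sub_distrib, ← Finset.mul_sum, Finset.sum_add_distrib,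
    mul_assoc]
  have h5 : ∀ j, pderiv' (fun y => u y t) j x * ((B (u x t) + δ) * pderiv' (fun y => u y t) j x)
      = (B (u x t) + δ) * pderiv' (fun y => u y t) j x ^ 2 := fun j => by ring
  simp only [h5, ← Finset.mul_sum]
  generalize ∑ j, pderiv' (fun y => (B (u y t) + δ) * pderiv' (fun y => u y t) j y) j x = S
  ring

/-- By the boundary condition, `u` is small outside a compact subset of `Ω`, uniformly on compact
time intervals. -/
theorem exists_isCompact_abs_le (hu : IsClassicalSolution Ω T ε δ f B u₀ u) (hΩ : IsOpen Ω)
    (hΩb : Bornology.IsBounded Ω) {a b η : ℝ} (hab : Icc a b ⊆ Ioo 0 T) (hη : 0 < η) :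
    ∃ K ⊆ Ω, IsCompact K ∧ ∀ x ∈ Ω \ K, ∀ t ∈ Icc a b, |u x t| ≤ η := by
  have hcomp : IsCompact (closure Ω ×ˢ Icc a b) := hΩb.isCompact_closure.prod isCompact_Icc
  have hcont : ContinuousOn (fun p : (Fin d → ℝ) × ℝ => |u p.1 p.2|) (closure Ω ×ˢ Icc a b) :=
    (hu.cont.mono (prod_mono subset_rfl (hab.trans Ioo_subset_Icc_self))).abs
  have hK : IsCompact ((closure Ω ×ˢ Icc a b) ∩ (fun p => |u p.1 p.2|) ⁻¹' Ici η) :=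
    hcomp.of_isClosed_subset (hcont.preimage_isClosed_of_isClosed hcomp.isClosed isClosed_Ici)
      inter_subset_left
  refine ⟨_, ?_, hK.image continuous_fst, ?_⟩
  · rintro _ ⟨⟨x, t⟩, ⟨hxt, hle⟩, rfl⟩
    by_contra hx
    have hfr : x ∈ frontier Ω := by rw [hΩ.frontier_eq]; exact ⟨hxt.1, hx⟩
    have h0 := hu.bc x hfr t (hab hxt.2)
    have hle' : η ≤ |u x t| := hle
    rw [h0, abs_zero] at hle'
    exact hη.not_ge hle'
  · intro x hx t ht
    by_contra hlt
    exact hx.2 ⟨(x, t), ⟨⟨subset_closure hx.1, ht⟩, (not_le.1 hlt).le⟩, rfl⟩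

theorem integrableOn_sq (hu : IsClassicalSolution Ω T ε δ f B u₀ u)
    (hΩb : Bornology.IsBounded Ω) {t : ℝ} (ht : t ∈ Icc 0 T) :
    IntegrableOn (fun x => u x t ^ 2) Ω := by
  have hc : ContinuousOn (fun x => u x t) (closure Ω) :=
    hu.cont.comp (f := fun x => (x, t)) (by fun_prop) fun _ hx => ⟨hx, ht⟩
  exact ((hc.pow 2).integrableOn_compact hΩb.isCompact_closure).mono_set subset_closure

/-- The truncated energy inequality. -/
theorem truncated_energy_le (hu : IsClassicalSolution Ω T ε δ f B u₀ u) (hΩ : IsOpen Ω)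
    (hΩb : Bornology.IsBounded Ω) (hε : 0 ≤ ε) (hδ : 0 ≤ δ) (hf : ∀ j, ContDiff ℝ 2 (f j))
    (hB : ContDiff ℝ 1 B) (hB0 : ∀ y, 0 ≤ B y) {a b η : ℝ} (ha : 0 < a) (hab : a ≤ b) (hb : b < T)
    (hη : 0 < η) {S : Set ((Fin d → ℝ) × ℝ)} (hS : IsCompact S) (hSΩ : S ⊆ Ω ×ˢ Icc a b)
    (j : Fin d) :
    ε * ∫ q in S, cutoff η (u q.1 q.2) * (B (u q.1 q.2) * pderiv' (fun y => u y q.2) j q.1 ^ 2)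
      ≤ (∫ x in Ω, u x a ^ 2) / 2 := by
  have hI : Icc a b ⊆ Ioo 0 T := fun t ht => ⟨ha.trans_le ht.1, ht.2.trans_lt hb⟩
  obtain ⟨K₁, hK₁Ω, hK₁, hsmall⟩ := hu.exists_isCompact_abs_le hΩ hΩb hI hη
  set K := K₁ ∪ Prod.fst '' S with hKdef
  have hK : IsCompact K := hK₁.union (hS.image continuous_fst)
  have hKΩ : K ⊆ Ω := union_subset hK₁Ω (by rintro _ ⟨q, hq, rfl⟩; exact (hSΩ hq).1)
  have hSK : S ⊆ K ×ˢ Icc a b := fun q hq => ⟨Or.inr ⟨q, hq, rfl⟩, (hSΩ hq).2⟩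
  have hKI : K ×ˢ Icc a b ⊆ Ω ×ˢ Ioo 0 T := prod_mono hKΩ hI
  have hcomp : ∀ {h : ℝ → ℝ}, Continuous h →
      ContinuousOn (fun q : (Fin d → ℝ) × ℝ => h (u q.1 q.2)) (Ω ×ˢ Ioo 0 T) :=
    fun hh => hh.comp_continuousOn hu.continuousOn_u
  have hint : ∀ {k : (Fin d → ℝ) × ℝ → ℝ}, ContinuousOn k (Ω ×ˢ Ioo 0 T) →
      IntegrableOn k (K ×ˢ Icc a b) := fun hk =>
    (hk.mono hKI).integrableOn_compact (hK.prod isCompact_Icc)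
  set e : (Fin d → ℝ) × ℝ → ℝ := fun q => cutoffId η (u q.1 q.2) * deriv (u q.1) q.2 with he
  set D : (Fin d → ℝ) × ℝ → ℝ := fun q => ∑ i, cutoff η (u q.1 q.2) * (B (u q.1 q.2) + δ)
    * pderiv' (fun y => u y q.2) i q.1 ^ 2 with hD
  set P : (Fin d → ℝ) × ℝ → ℝ := fun q => cutoff η (u q.1 q.2) * (B (u q.1 q.2)
    * pderiv' (fun y => u y q.2) j q.1 ^ 2) with hP
  have hec : ContinuousOn e (Ω ×ˢ Ioo 0 T) := (hcomp (continuous_cutoffId η)).mul hu.cont_dt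
  have hDc : ContinuousOn D (Ω ×ˢ Ioo 0 T) := continuousOn_finsetSum _ fun i _ =>
    ((hcomp (continuous_cutoff η)).mul ((hcomp hB.continuous).add continuousOn_const)).mul
      ((hu.cont_dx i).pow 2)
  have hPc : ContinuousOn P (Ω ×ˢ Ioo 0 T) :=
    (hcomp (continuous_cutoff η)).mul ((hcomp hB.continuous).mul ((hu.cont_dx j).pow 2))
  have hP0 : ∀ q, 0 ≤ P q := fun q =>
    mul_nonneg (cutoff_nonneg _ _) (mul_nonneg (hB0 _) (sq_nonneg _))
  have hPD : ∀ q, P q ≤ D q := by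
    intro q
    have h1 : ∀ i, 0 ≤ cutoff η (u q.1 q.2) * (B (u q.1 q.2) + δ)
        * pderiv' (fun y => u y q.2) i q.1 ^ 2 := fun i =>
      mul_nonneg (mul_nonneg (cutoff_nonneg _ _) (add_nonneg (hB0 _) hδ)) (sq_nonneg _)
    refine le_trans ?_ (Finset.single_le_sum (fun i _ => h1 i) (Finset.mem_univ j))
    rw [hP, mul_assoc]
    have := cutoff_nonneg η (u q.1 q.2)
    dsimp only
    gcongr
    linarith
  have hbal : ∫ q in K ×ˢ Icc a b, (e q + ε * D q) = 0 := by
    have hi := hint (hec.add (hDc.const_mul ε))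
    rw [Measure.volume_eq_prod, IntegrableOn, ← Measure.prod_restrict] at hi
    rw [Measure.volume_eq_prod, ← Measure.prod_restrict]
    refine (integral_prod_symm _ hi).trans ?_
    refine (setIntegral_congr_fun measurableSet_Icc fun t ht => ?_).trans (integral_zero _ _)
    exact hu.setIntegral_energy_eq_zero hΩ hf hB hη (hI ht) hK hKΩ
      fun x hx => hsmall x ⟨hx.1, fun h => hx.2 (Or.inl h)⟩ t ht
  have htime : -((∫ x in Ω, u x a ^ 2) / 2) ≤ ∫ q in K ×ˢ Icc a b, e q := by
    have hi := hint hec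
    rw [Measure.volume_eq_prod] at hi
    rw [Measure.volume_eq_prod, setIntegral_prod _ hi]
    have hsq := hu.integrableOn_sq hΩb (Ioo_subset_Icc_self (hI (left_mem_Icc.2 hab)))
    have h1 : ∫ x in K, u x a ^ 2 ≤ ∫ x in Ω, u x a ^ 2 :=
      setIntegral_mono_set hsq (Filter.Eventually.of_forall fun _ => sq_nonneg _)
        hKΩ.eventuallyLE
    have h2 : ∫ x in K, -(u x a ^ 2 / 2) ≤ ∫ x in K, ∫ t in Icc a b, e (x, t) := by
      refine setIntegral_mono_on ((hsq.mono_set hKΩ).div_const 2).neg ?_ hK.measurableSet ?_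
      · rw [IntegrableOn, ← Measure.prod_restrict] at hi
        exact hi.integral_prod_left
      · intro x hx
        have hsub : uIcc a b ⊆ Ioo 0 T := by rwa [uIcc_of_le hab]
        have hder : ∀ t ∈ uIcc a b, HasDerivAt (fun t => cutoffEnergy η (u x t)) (e (x, t)) t :=
          fun t ht => (hasDerivAt_cutoffEnergy η (u x t)).comp t
            (hu.diff_t x (hKΩ hx) t (hsub ht)).hasDerivAt
        have hc : ContinuousOn (fun t => e (x, t)) (uIcc a b) :=
          hec.comp (by fun_prop) fun t ht => ⟨hKΩ hx, hsub ht⟩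
        have h3 := intervalIntegral.integral_eq_sub_of_hasDerivAt hder hc.intervalIntegrable
        rw [intervalIntegral.integral_of_le hab, ← integral_Icc_eq_integral_Ioc] at h3
        rw [h3]
        linarith [cutoffEnergy_nonneg η (u x b), cutoffEnergy_le η (u x a)]
    rw [integral_neg, integral_div] at h2
    linarith
  rw [integral_add (hint hec) ((hint hDc).const_mul ε), integral_const_mul] at hbal
  have h1 : ∫ q in S, P q ≤ ∫ q in K ×ˢ Icc a b, D q :=
    (setIntegral_mono_set (hint hPc) (Filter.Eventually.of_forall hP0) hSK.eventuallyLE).trans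
      (integral_mono (hint hPc) (hint hDc) hPD)
  nlinarith [mul_le_mul_of_nonneg_left h1 hε]

theorem tendsto_setIntegral_sq (hu : IsClassicalSolution Ω T ε δ f B u₀ u) (hΩ : IsOpen Ω)
    (hΩb : Bornology.IsBounded Ω) (hT : 0 < T) :
    Filter.Tendsto (fun a => ∫ x in Ω, u x a ^ 2) (nhdsWithin 0 (Ioi 0))
      (nhds (∫ x in Ω, u₀ x ^ 2)) := by
  obtain ⟨C, hC⟩ := (hΩb.isCompact_closure.prod isCompact_Icc).exists_bound_of_continuousOn hu.cont
  have hmem : ∀ᶠ a in nhdsWithin (0 : ℝ) (Ioi 0), a ∈ Icc 0 T :=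
    (Ioo_mem_nhdsGT hT : Ioo 0 T ∈ nhdsWithin 0 (Ioi 0)) |> Filter.mem_of_superset <|
      Ioo_subset_Icc_self
  refine tendsto_integral_filter_of_dominated_convergence (fun _ => C ^ 2) ?_ ?_ ?_ ?_
  · filter_upwards [hmem] with a ha using (hu.integrableOn_sq hΩb ha).aestronglyMeasurable
  · filter_upwards [hmem] with a ha
    refine ae_restrict_of_forall_mem hΩ.measurableSet fun x hx => ?_
    have := hC (x, a) ⟨subset_closure hx, ha⟩
    rw [norm_pow]
    exact pow_le_pow_left₀ (norm_nonneg _) this 2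
  · exact integrableOn_const hΩb.measure_lt_top.ne
  · refine ae_restrict_of_forall_mem hΩ.measurableSet fun x hx => ?_
    have h0 : ContinuousOn (u x) (Icc 0 T) :=
      hu.cont.comp (f := fun t => (x, t)) (by fun_prop) fun _ ht => ⟨subset_closure hx, ht⟩
    have h1 := (h0 0 (left_mem_Icc.2 hT.le)).tendsto
    rw [hu.ic x hx] at h1
    exact (h1.mono_left (le_inf nhdsWithin_le_nhds (Filter.le_principal_iff.2 hmem))).pow 2

/-- The energy inequality for the `j`-th derivative on compact subsets of `Ω × (0,T)`. -/
theorem energy_le (hu : IsClassicalSolution Ω T ε δ f B u₀ u) (hΩ : IsOpen Ω)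
    (hΩb : Bornology.IsBounded Ω) (hT : 0 < T) (hε : 0 ≤ ε) (hδ : 0 ≤ δ)
    (hf : ∀ j, ContDiff ℝ 2 (f j)) (hB : ContDiff ℝ 1 B) (hB0 : ∀ y, 0 ≤ B y)
    {S : Set ((Fin d → ℝ) × ℝ)} (hS : IsCompact S) (hSΩ : S ⊆ Ω ×ˢ Ioo 0 T) (j : Fin d) :
    ε * ∫ q in S, B (u q.1 q.2) * pderiv' (fun y => u y q.2) j q.1 ^ 2
      ≤ (∫ x in Ω, u₀ x ^ 2) / 2 := by
  have hS₂ : Prod.snd '' S ⊆ Ioo 0 T := by rintro _ ⟨q, hq, rfl⟩; exact (hSΩ hq).2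
  obtain ⟨c, b, hc, hcb, hb, hScb⟩ :
      ∃ c b, 0 < c ∧ c ≤ b ∧ b < T ∧ Prod.snd '' S ⊆ Icc c b := by
    rcases (Prod.snd '' S).eq_empty_or_nonempty with h | h
    · exact ⟨T / 2, T / 2, by linarith, le_rfl, by linarith, by simp [h]⟩
    · have hcp := hS.image continuous_snd
      have h1 := hcp.sInf_mem h
      have h2 := hcp.sSup_mem h
      exact ⟨_, _, (hS₂ h1).1, csInf_le hcp.bddBelow h2, (hS₂ h2).2,
        fun t ht => ⟨csInf_le hcp.bddBelow ht, le_csSup hcp.bddAbove ht⟩⟩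
  have htrunc : ∀ η > 0, ε * ∫ q in S, cutoff η (u q.1 q.2)
      * (B (u q.1 q.2) * pderiv' (fun y => u y q.2) j q.1 ^ 2) ≤ (∫ x in Ω, u₀ x ^ 2) / 2 := by
    intro η hη
    refine ge_of_tendsto ((hu.tendsto_setIntegral_sq hΩ hΩb hT).div_const 2) ?_
    filter_upwards [Ioo_mem_nhdsGT hc] with a ha
    refine hu.truncated_energy_le hΩ hΩb hε hδ hf hB hB0 ha.1 (ha.2.le.trans hcb) hb hη hS ?_ j
    intro q hq
    have := hScb ⟨q, hq, rfl⟩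
    exact ⟨(hSΩ hq).1, ha.2.le.trans this.1, this.2⟩
  have hcomp : ∀ {h : ℝ → ℝ}, Continuous h →
      ContinuousOn (fun q : (Fin d → ℝ) × ℝ => h (u q.1 q.2)) (Ω ×ˢ Ioo 0 T) :=
    fun hh => hh.comp_continuousOn hu.continuousOn_u
  have hPc : ContinuousOn (fun q : (Fin d → ℝ) × ℝ =>
      B (u q.1 q.2) * pderiv' (fun y => u y q.2) j q.1 ^ 2) (Ω ×ˢ Ioo 0 T) :=
    (hcomp hB.continuous).mul ((hu.cont_dx j).pow 2)
  have hae : ∀ᵐ q : (Fin d → ℝ) × ℝ, q ∈ Ω ×ˢ Ioo 0 T → u q.1 q.2 = 0 →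
      pderiv' (fun y => u y q.2) j q.1 = 0 := by
    have : (volume : Measure ((Fin d → ℝ) × ℝ)).IsAddHaarMeasure :=
      Measure.prod.instIsAddHaarMeasure _ _
    refine ae_lineDeriv_eq_zero_of_eq_zero volume (hΩ.prod isOpen_Ioo)
      (w := fun q => u q.1 q.2) (v := (Pi.single j 1, 0)) hu.continuousOn_u (hu.cont_dx j) ?_
    intro q hq
    have := hu.hasLineDerivAt_x j hq.1 hq.2
    simpa [HasLineDerivAt] using this
  have hlim : Filter.Tendsto (fun n : ℕ => ∫ q in S, cutoff (1 / ((n : ℝ) + 1)) (u q.1 q.2)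
      * (B (u q.1 q.2) * pderiv' (fun y => u y q.2) j q.1 ^ 2)) Filter.atTop
      (nhds (∫ q in S, B (u q.1 q.2) * pderiv' (fun y => u y q.2) j q.1 ^ 2)) := by
    refine tendsto_integral_filter_of_dominated_convergence
      (fun q => B (u q.1 q.2) * pderiv' (fun y => u y q.2) j q.1 ^ 2) ?_ ?_
      ((hPc.mono hSΩ).integrableOn_compact hS) ?_
    · exact Filter.Eventually.of_forall fun n => (((hcomp (continuous_cutoff _)).mul
        hPc).mono hSΩ).aestronglyMeasurable hS.measurableSet
    · refine Filter.Eventually.of_forall fun n => Filter.Eventually.of_forall fun q => ?_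
      have hnn : 0 ≤ B (u q.1 q.2) * pderiv' (fun y => u y q.2) j q.1 ^ 2 :=
        mul_nonneg (hB0 _) (sq_nonneg _)
      rw [Real.norm_of_nonneg (mul_nonneg (cutoff_nonneg _ _) hnn)]
      exact mul_le_of_le_one_left hnn (cutoff_le_one _ _)
    · filter_upwards [ae_restrict_of_ae hae, ae_restrict_mem hS.measurableSet] with q hq hqS
      by_cases h0 : u q.1 q.2 = 0
      · simp [hq (hSΩ hqS) h0]
      · refine tendsto_const_nhds.congr' ?_
        have hpos : 0 < |u q.1 q.2| / 2 := by positivity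
        filter_upwards [tendsto_one_div_add_atTop_nhds_zero_nat.eventually_lt_const hpos]
          with n hn
        rw [cutoff_of_two_mul_le (by positivity) (by linarith), one_mul]
  exact le_of_tendsto (hlim.const_mul ε)
    (Filter.Eventually.of_forall fun n => htrunc _ (by positivity))

end IsClassicalSolution

end ClassicalSolution

theorem abs_integral_mul_le_sqrt_mul_sqrt {α : Type*} [MeasurableSpace α] {μ : Measure α}
    {g h : α → ℝ} (hg : MemLp g 2 μ) (hh : MemLp h 2 μ) :
    |∫ x, g x * h x ∂μ| ≤ √(∫ x, g x ^ 2 ∂μ) * √(∫ x, h x ^ 2 ∂μ) := by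
  have h1 := integral_mul_norm_le_Lp_mul_Lq (μ := μ) (f := g) (g := h) (p := 2) (q := 2)
    ⟨by norm_num, by norm_num, by norm_num⟩ (by simpa using hg) (by simpa using hh)
  simp only [Real.rpow_ofNat, Real.norm_eq_abs, sq_abs, ← Real.sqrt_eq_rpow] at h1
  refine (abs_integral_le_integral_abs).trans ?_
  simpa only [abs_mul] using h1

/-- **Smallness of the viscous term**: for a classical solution of the regularized problem,
`|ε ∫ B(u) ∂ⱼu ∂ⱼφ| ≤ √ε (sup B)^{1/2} (‖u₀‖_{L²(Ω)}/√2) ‖∂ⱼφ‖_{L²(Ω_T)}`. -/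
theorem viscous_term_estimate
    (d : ℕ) (Ω : Set (Fin d → ℝ)) (hΩopen : IsOpen Ω) (hΩbd : Bornology.IsBounded Ω)
    (T ε δ : ℝ) (hT : 0 < T) (hε : 0 < ε) (hδ : 0 < δ)
    (f : Fin d → ℝ → ℝ) (hf : ∀ j, ContDiff ℝ 2 (f j))
    (hf' : ∀ j, ∃ C, ∀ y : ℝ, |deriv (f j) y| ≤ C)
    (B : ℝ → ℝ) (hB : ContDiff ℝ 1 B) (hBbd : ∃ C, ∀ y : ℝ, |B y| ≤ C)
    (hBnonneg : ∀ y : ℝ, 0 ≤ B y)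
    (u₀ : (Fin d → ℝ) → ℝ) (hu₀smooth : ContDiff ℝ (⊤ : ℕ∞) u₀)
    (hu₀supp : HasCompactSupport u₀) (hu₀Ω : tsupport u₀ ⊆ Ω)
    (u : (Fin d → ℝ) → ℝ → ℝ) (hu : IsClassicalSolution Ω T ε δ f B u₀ u) :
    ∀ j : Fin d, ∀ φ : (Fin d → ℝ) × ℝ → ℝ, ContDiff ℝ (⊤ : ℕ∞) φ → HasCompactSupport φ →
      tsupport φ ⊆ Ω ×ˢ Set.Ioo 0 T →
      |ε * ∫ q in Ω ×ˢ Set.Ioo 0 T,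
          B (u q.1 q.2) * pderiv' (fun y => u y q.2) j q.1 *
            fderiv ℝ φ q (Pi.single j 1, 0)|
        ≤ Real.sqrt ε * Real.sqrt (⨆ y : ℝ, B y) *
            (Real.sqrt (∫ x in Ω, (u₀ x) ^ 2) / Real.sqrt 2) *
            Real.sqrt (∫ q in Ω ×ˢ Set.Ioo 0 T, (fderiv ℝ φ q (Pi.single j 1, 0)) ^ 2) := by

  intro j φ hφ hφs hφΩ
  set S := tsupport φ with hSdef
  have hS : IsCompact S := hφs
  set p : (Fin d → ℝ) × ℝ → ℝ := fun q => pderiv' (fun y => u y q.2) j q.1 with hp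
  set ψ : (Fin d → ℝ) × ℝ → ℝ := fun q => fderiv ℝ φ q (Pi.single j 1, 0) with hψ
  have hψc : Continuous ψ := (hφ.continuous_fderiv (by simp)).clm_apply continuous_const
  have hψ0 : ∀ q ∉ S, ψ q = 0 := fun q hq => by
    simp [hψ, fderiv_of_notMem_tsupport (𝕜 := ℝ) hq]
  have hm : MeasurableSet (Ω ×ˢ Ioo 0 T) := (hΩopen.prod isOpen_Ioo).measurableSet
  rw [setIntegral_eq_of_subset_of_forall_sdiff_eq_zero hm hφΩ
      (f := fun q => B (u q.1 q.2) * p q * ψ q) fun q hq => by simp [hψ0 q hq.2],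
    setIntegral_eq_of_subset_of_forall_sdiff_eq_zero hm hφΩ
      (f := fun q => ψ q ^ 2) fun q hq => by simp [hψ0 q hq.2]]
  have hBuc : ContinuousOn (fun q : (Fin d → ℝ) × ℝ => √(B (u q.1 q.2))) S :=
    ((hB.continuous.comp_continuousOn hu.continuousOn_u).mono hφΩ).sqrt
  have hmem : ∀ {k : (Fin d → ℝ) × ℝ → ℝ}, ContinuousOn k S → MemLp k 2 (volume.restrict S) :=
    fun hk => (memLp_two_iff_integrable_sq (hk.aestronglyMeasurable hS.measurableSet)).2
      ((hk.pow 2).integrableOn_compact hS)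
  have hCS : |∫ q in S, √(B (u q.1 q.2)) * p q * (√(B (u q.1 q.2)) * ψ q)|
      ≤ √(∫ q in S, (√(B (u q.1 q.2)) * p q) ^ 2)
        * √(∫ q in S, (√(B (u q.1 q.2)) * ψ q) ^ 2) := abs_integral_mul_le_sqrt_mul_sqrt
    (hmem (hBuc.mul ((hu.cont_dx j).mono hφΩ))) (hmem (hBuc.mul hψc.continuousOn))
  have hsq : ∀ q : (Fin d → ℝ) × ℝ, √(B (u q.1 q.2)) ^ 2 = B (u q.1 q.2) :=
    fun q => Real.sq_sqrt (hBnonneg _)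
  have hprod : ∀ q : (Fin d → ℝ) × ℝ,
      √(B (u q.1 q.2)) * p q * (√(B (u q.1 q.2)) * ψ q) = B (u q.1 q.2) * p q * ψ q := fun q => by
    rw [← hsq q]; simp only [Real.sqrt_sq (Real.sqrt_nonneg _)]; ring
  simp only [hprod, mul_pow, hsq] at hCS
  have hE := hu.energy_le hΩopen hΩbd hT hε.le hδ.le hf hB hBnonneg hS hφΩ j
  have hBdd : BddAbove (range B) := by
    obtain ⟨C, hC⟩ := hBbd
    exact ⟨C, by rintro _ ⟨y, rfl⟩; exact (le_abs_self _).trans (hC y)⟩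
  set M := ⨆ y : ℝ, B y
  have hψB : ∫ q in S, B (u q.1 q.2) * ψ q ^ 2 ≤ M * ∫ q in S, ψ q ^ 2 := by
    rw [← integral_const_mul]
    refine setIntegral_mono_on ?_ ?_ hS.measurableSet fun q _ =>
      mul_le_mul_of_nonneg_right (le_ciSup hBdd _) (sq_nonneg _)
    · exact ((((hB.continuous.comp_continuousOn hu.continuousOn_u).mono hφΩ)).mul
        (hψc.pow 2).continuousOn).integrableOn_compact hS
    · exact ((hψc.pow 2).const_mul M).continuousOn.integrableOn_compact hS
  have hM : 0 ≤ M := (hBnonneg 0).trans (le_ciSup hBdd 0)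
  set X := ∫ q in S, B (u q.1 q.2) * p q ^ 2
  set Y := ∫ q in S, ψ q ^ 2
  set I := ∫ x in Ω, u₀ x ^ 2
  have hεX : √ε * √X ≤ √I / √2 := by
    rw [← Real.sqrt_mul hε.le, ← Real.sqrt_div' _ zero_le_two]
    exact Real.sqrt_le_sqrt hE
  have hY : √(∫ q in S, B (u q.1 q.2) * ψ q ^ 2) ≤ √M * √Y := by
    rw [← Real.sqrt_mul hM]
    exact Real.sqrt_le_sqrt hψB
  rw [abs_mul, abs_of_pos hε]
  calc ε * |∫ q in S, B (u q.1 q.2) * p q * ψ q|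
      ≤ ε * (√X * (√M * √Y)) := by gcongr; exact hCS.trans (by gcongr)
    _ = √ε * √M * (√ε * √X) * √Y := by
        nth_rewrite 1 [← Real.mul_self_sqrt hε.le]; ring
    _ ≤ √ε * √M * (√I / √2) * √Y := by gcongr
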